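/- arXiv:2108.01909 — 2 statements merged into one kernel-verified Lean document; each statement's English description precedes it below -/
import Mathlib

section
/- Let X : (0,1) → ℝ be measurable with ∫₀¹ X(x)⁶ dx < ∞, and let τ be a real number with 0 < τ ≤ 1 and τ ∫₀¹ X(x)⁶ dx ≤ 2 ∫₀¹ X(x)⁴ dx. Then ∫₀¹ X(x)(X(x) − X(x)³) dx + (τ/2) ∫₀¹ (X(x) − X(x)³)² dx ≤ (3/2) ∫₀¹ X(x)² dx. -/
open MeasureTheory

/-- On a finite measure space, integrability of `f ^ n` implies that of every lower power. -/
theorem integrable_pow_of_le {α : Type*} [MeasurableSpace α] {μ : Measure α} [IsFiniteMeasure μ]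
    {f : α → ℝ} (hf : AEStronglyMeasurable f μ) {m n : ℕ} (hmn : m ≤ n)
    (hn : Integrable (fun x => f x ^ n) μ) : Integrable (fun x => f x ^ m) μ := by
  refine ((integrable_const (1 : ℝ)).add hn.norm).mono' (hf.pow m) (.of_forall fun x => ?_)
  simp only [Pi.add_apply, norm_pow]
  rcases le_total ‖f x‖ 1 with h | h
  · linarith [pow_le_one₀ (n := m) (norm_nonneg (f x)) h, pow_nonneg (norm_nonneg (f x)) n]
  · linarith [pow_le_pow_right₀ h hmn]

/-- Verification of Assumption 3.5: ⟨X, F(X)⟩ + (τ/2)‖F(X)‖² ≤ (3/2)‖X‖² for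
F(X) = X − X³ when τ ≤ 1 and τ‖X‖_{L⁶}⁶ ≤ 2‖X‖_{L⁴}⁴. -/
theorem stmt_13 (X : ℝ → ℝ) (hX : Measurable X)
    (hX6 : IntegrableOn (fun x => X x ^ 6) (Set.Ioo 0 1))
    (τ : ℝ) (hτ : 0 < τ) (hτ1 : τ ≤ 1)
    (hbd : τ * ∫ x in Set.Ioo (0:ℝ) 1, X x ^ 6 ≤ 2 * ∫ x in Set.Ioo (0:ℝ) 1, X x ^ 4) :
    (∫ x in Set.Ioo (0:ℝ) 1, X x * (X x - X x ^ 3)) +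
      τ / 2 * ∫ x in Set.Ioo (0:ℝ) 1, (X x - X x ^ 3) ^ 2 ≤
      3 / 2 * ∫ x in Set.Ioo (0:ℝ) 1, X x ^ 2 := by
  have h2 := integrable_pow_of_le hX.aestronglyMeasurable (show 2 ≤ 6 by norm_num) hX6
  have h4 := integrable_pow_of_le hX.aestronglyMeasurable (show 4 ≤ 6 by norm_num) hX6
  have inner_eq : ∫ x in Set.Ioo (0:ℝ) 1, X x * (X x - X x ^ 3) =
      (∫ x in Set.Ioo (0:ℝ) 1, X x ^ 2) - ∫ x in Set.Ioo (0:ℝ) 1, X x ^ 4 := by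
    rw [← integral_sub h2 h4]
    congr with x
    ring
  have norm_eq : ∫ x in Set.Ioo (0:ℝ) 1, (X x - X x ^ 3) ^ 2 =
      (∫ x in Set.Ioo (0:ℝ) 1, X x ^ 2) - 2 * (∫ x in Set.Ioo (0:ℝ) 1, X x ^ 4) +
        ∫ x in Set.Ioo (0:ℝ) 1, X x ^ 6 := by
    rw [← integral_const_mul, ← integral_sub h2 (h4.const_mul 2),
      ← integral_add (by exact h2.sub (h4.const_mul 2)) hX6]
    congr with x
    ring
  have nonneg2 : 0 ≤ ∫ x in Set.Ioo (0:ℝ) 1, X x ^ 2 := integral_nonneg fun x => by positivity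
  have nonneg4 : 0 ≤ ∫ x in Set.Ioo (0:ℝ) 1, X x ^ 4 := integral_nonneg fun x => by positivity
  rw [inner_eq, norm_eq]
  linarith [mul_nonneg (sub_nonneg.2 hτ1) nonneg2, mul_nonneg hτ.le nonneg4]
end

section
/- Let X : (0,1) → ℝ be measurable with ∫₀¹ X(x)⁶ dx < ∞, and let τ be a real number with 0 < τ ≤ 1 and τ ∫₀¹ X(x)⁶ dx ≤ ∫₀¹ X(x)² dx. Then ∫₀¹ X(x)(X(x) − X(x)³) dx + (τ/2) ∫₀¹ (X(x) − X(x)³)² dx ≤ 2 ∫₀¹ X(x)² dx. -/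
open MeasureTheory

/-- Verification of Assumption 3.5: ⟨X, F(X)⟩ + (τ/2)‖F(X)‖² ≤ 2‖X‖² for
F(X) = X − X³ when τ ≤ 1 and τ‖X‖_{L⁶}⁶ ≤ ‖X‖². -/
theorem stmt_14 (X : ℝ → ℝ) (hX : Measurable X)
    (hX6 : IntegrableOn (fun x => X x ^ 6) (Set.Ioo 0 1))
    (τ : ℝ) (hτ : 0 < τ) (hτ1 : τ ≤ 1)
    (hbd : τ * ∫ x in Set.Ioo (0:ℝ) 1, X x ^ 6 ≤ ∫ x in Set.Ioo (0:ℝ) 1, X x ^ 2) :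
    (∫ x in Set.Ioo (0:ℝ) 1, X x * (X x - X x ^ 3)) +
      τ / 2 * ∫ x in Set.Ioo (0:ℝ) 1, (X x - X x ^ 3) ^ 2 ≤
      2 * ∫ x in Set.Ioo (0:ℝ) 1, X x ^ 2 := by
  have integrable_of_le (k : ℕ) (hk : ∀ y : ℝ, |y ^ k| ≤ 1 + y ^ 6) :
      IntegrableOn (fun x => X x ^ k) (Set.Ioo 0 1) := by
    have h1 : IntegrableOn (fun _ : ℝ => (1 : ℝ)) (Set.Ioo 0 1) :=
      integrableOn_const (by simp)
    exact (h1.add hX6).mono' (hX.pow_const k).aestronglyMeasurable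
      (Filter.Eventually.of_forall fun x => hk (X x))
  have hX2 := integrable_of_le 2 fun y => by
    rw [abs_of_nonneg (by positivity)]
    nlinarith [mul_nonneg (sq_nonneg y) (sq_nonneg (y ^ 2 - 1)), sq_nonneg (y ^ 2 - 1)]
  have hX4 := integrable_of_le 4 fun y => by
    rw [abs_of_nonneg (by positivity)]
    nlinarith [mul_nonneg (sq_nonneg y) (sq_nonneg (y ^ 2 - 1)), sq_nonneg (y ^ 2 - 1)]
  have inner_eq : ∫ x in Set.Ioo (0:ℝ) 1, X x * (X x - X x ^ 3) =
      (∫ x in Set.Ioo (0:ℝ) 1, X x ^ 2) - ∫ x in Set.Ioo (0:ℝ) 1, X x ^ 4 := by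
    rw [← integral_sub hX2 hX4]
    congr 1 with x
    ring
  have norm_sq_eq : ∫ x in Set.Ioo (0:ℝ) 1, (X x - X x ^ 3) ^ 2 =
      (∫ x in Set.Ioo (0:ℝ) 1, X x ^ 2) - 2 * (∫ x in Set.Ioo (0:ℝ) 1, X x ^ 4) +
        ∫ x in Set.Ioo (0:ℝ) 1, X x ^ 6 := by
    have hsub : IntegrableOn (fun x => X x ^ 2 - 2 * X x ^ 4) (Set.Ioo 0 1) :=
      hX2.sub (hX4.const_mul 2)
    rw [← integral_const_mul, ← integral_sub hX2 (hX4.const_mul 2),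
      ← integral_add hsub hX6]
    congr 1 with x
    ring
  have h2 : 0 ≤ ∫ x in Set.Ioo (0:ℝ) 1, X x ^ 2 := integral_nonneg fun x => by positivity
  have h4 : 0 ≤ ∫ x in Set.Ioo (0:ℝ) 1, X x ^ 4 := integral_nonneg fun x => by positivity
  rw [inner_eq, norm_sq_eq]
  nlinarith [mul_nonneg hτ.le h4, mul_le_mul_of_nonneg_right hτ1 h2]
end
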